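/- Let F ⊆ E be fields with E/F a finite Galois extension, and let x, y ∈ E with x ≠ 0. Then the vectors (σ(x))_{σ ∈ Gal(E/F)} and (σ(y))_{σ ∈ Gal(E/F)} in E^{Gal(E/F)} are linearly dependent over E if and only if y/x ∈ F (i.e., y = λ·x for some λ in the image of F in E). In particular, for the degree-3 cyclic extension with Galois group generated by τ, the 2×3 matrix with rows (x, τ(x), τ²(x)) and (y, τ(y), τ²(y)) has rank 2 if and only if y/x ∉ F. -/

import Mathlib

/-- For a finite Galois extension E/F and x, y ∈ E with x ≠ 0, the vectors
(σ(x))_σ and (σ(y))_σ indexed by σ ∈ Gal(E/F) are linearly dependent over E iff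
y/x ∈ F, i.e. y = λ·x for some λ in the image of F in E. (This is the full-rank
criterion for the rows of the paper's two-user transmission matrix.) -/
theorem galois_conjugate_vectors_dependent_iff
    (F E : Type*) [Field F] [Field E] [Algebra F E]
    [FiniteDimensional F E] [IsGalois F E] (x y : E) (hx : x ≠ 0) :
    ¬ LinearIndependent E
        ![fun σ : E ≃ₐ[F] E => σ x, fun σ : E ≃ₐ[F] E => σ y] ↔
      ∃ lam : F, y = algebraMap F E lam * x := by
  have hv : (fun σ : E ≃ₐ[F] E => σ x) ≠ 0 := by
    intro h
    exact hx (by simpa using congrFun h AlgEquiv.refl)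
  rw [LinearIndependent.pair_iff' hv]
  push Not
  constructor
  · rintro ⟨a, ha⟩
    have h : ∀ σ : E ≃ₐ[F] E, a * σ x = σ y := fun σ => by
      simpa using congrFun ha σ
    have h1 : a * x = y := by simpa using h AlgEquiv.refl
    have hfix : ∀ σ : E ≃ₐ[F] E, σ a = a := fun σ => by
      have h2 := h σ
      rw [← h1, map_mul] at h2
      have hσ : σ x ≠ 0 := by simpa using hx
      exact (mul_right_cancel₀ hσ h2).symm
    obtain ⟨l, hl⟩ := (IsGalois.mem_range_algebraMap_iff_fixed (F := F) a).2 hfix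
    exact ⟨l, by rw [hl, h1]⟩
  · rintro ⟨l, rfl⟩
    refine ⟨algebraMap F E l, ?_⟩
    funext σ
    simp
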